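/- arXiv:2208.14521 — 2 statements merged into one kernel-verified Lean document; each statement's English description precedes it below -/
import Mathlib

section
/- Let b, c be positive integers with b·c ≤ 3. Then there are only finitely many functions x : ℤ → ℤ such that x(i) ≥ 1 for all i ∈ ℤ and x(i−1)·x(i+1) = x(i)^b + 1 for odd i and x(i−1)·x(i+1) = x(i)^c + 1 for even i. (Finiteness of positive integral friezes for the rank-2 Dynkin types A₂, B₂/C₂, G₂ and A₁×A₁.) -/
/-- If `u ≤ k` and `u * k - 1` divides `u ^ 2 + k`, then `k ≤ 5`. -/
theorem le_five_of_mul_sub_one_dvd_sq_add {u k n : ℤ} (hu : 1 ≤ u) (huk : u ≤ k) (hn : 1 ≤ n)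
    (h : n * (u * k - 1) = u ^ 2 + k) : k ≤ 5 := by
  by_contra! hk
  have hone : u * k - 1 ≤ u ^ 2 + k := by nlinarith [mul_le_mul_of_nonneg_left huk (by lia : 0 ≤ u)]
  have htwo : n = 1 ∨ 2 * (u * k - 1) ≤ u ^ 2 + k := by
    rcases hn.eq_or_lt with h1 | h1
    · exact .inl h1.symm
    · right
      nlinarith [mul_le_mul_of_nonneg_left huk (by lia : 0 ≤ u)]
  rcases le_or_gt u 3 with hu3 | hu3
  · interval_cases u
    · rcases htwo with rfl | htwo <;> lia
    · lia
    · lia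
  · have hk1 : k ≤ u + 1 := by
      by_contra! hk2
      nlinarith
    obtain rfl | rfl : k = u ∨ k = u + 1 := by lia
    · rcases htwo with rfl | htwo <;> nlinarith
    · rcases htwo with rfl | htwo <;> nlinarith

/-- Bound on two consecutive exponent-`c` entries `u`, `k` of a positive integral frieze with
exponents `(1, c)`; they sit in the stretch `s`, `t`, `u`, `v`, `k`, `w`, `z`. -/
theorem frieze_entries_le_five {c : ℕ} (hc : 1 ≤ c) (hc3 : c ≤ 3) {s t u v k w z : ℤ}
    (hs : 1 ≤ s) (hu : 1 ≤ u) (hv : 1 ≤ v) (hk : 1 ≤ k) (hz : 1 ≤ z)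
    (hsu : s * u = t + 1) (htv : t * v = u ^ c + 1) (huk : u * k = v + 1)
    (hvw : v * w = k ^ c + 1) (hkz : k * z = w + 1) : u ≤ 5 ∧ k ≤ 5 := by
  obtain ⟨d, rfl⟩ : ∃ d, c = d + 1 := ⟨c - 1, by lia⟩
  obtain rfl : v = u * k - 1 := by lia
  have hleft : s * (u * k - 1) = u ^ d + k := by
    apply mul_left_cancel₀ (by lia : u ≠ 0)
    linear_combination (u * k - 1) * hsu + htv
  have hright : z * (u * k - 1) = k ^ d + u := by
    apply mul_left_cancel₀ (by lia : k ≠ 0)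
    linear_combination (u * k - 1) * hkz + hvw
  obtain rfl | rfl | rfl : d = 0 ∨ d = 1 ∨ d = 2 := by lia
  · have h1 : u * k - 1 ≤ 1 + k := by nlinarith
    have h2 : u * k - 1 ≤ 1 + u := by nlinarith
    constructor
    · by_contra! h
      obtain rfl : k = 1 := by nlinarith
      rcases hs.eq_or_lt with rfl | h3
      · lia
      rcases hz.eq_or_lt with rfl | h4
      · lia
      nlinarith
    · by_contra! h
      obtain rfl : u = 1 := by nlinarith
      rcases hs.eq_or_lt with rfl | h3
      · lia
      nlinarith
  · have h1 : u * k - 1 ≤ u + k := by nlinarith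
    rcases hs.eq_or_lt with rfl | h3
    · have h4 : (u - 1) * (k - 1) = 2 := by linear_combination hleft
      have h5 := Int.le_of_dvd two_pos (Dvd.intro _ h4)
      have h6 := Int.le_of_dvd two_pos (Dvd.intro_left _ h4)
      lia
    · have h4 : 2 * (u * k - 1) ≤ u + k := by nlinarith
      constructor <;> nlinarith
  · rcases le_total u k with h | h
    · have := le_five_of_mul_sub_one_dvd_sq_add hu h hs hleft
      lia
    · have := le_five_of_mul_sub_one_dvd_sq_add hk h hz (by linear_combination hright)
      lia

/-- A sequence with nonzero entries in which `x (i - 1) * x (i + 1)` is a function of `i` and `x i`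
is determined by two consecutive entries. -/
theorem eq_of_mul_recurrence {x y : ℤ → ℤ} {f : ℤ → ℤ → ℤ} (hx0 : ∀ i, x i ≠ 0)
    (hx : ∀ i, x (i - 1) * x (i + 1) = f i (x i)) (hy : ∀ i, y (i - 1) * y (i + 1) = f i (y i))
    (h0 : x 0 = y 0) (h1 : x 1 = y 1) : x = y := by
  suffices h : ∀ i, x i = y i ∧ x (i + 1) = y (i + 1) from funext fun i => (h i).1
  intro i
  induction i using Int.induction_on with
  | zero => exact ⟨h0, h1⟩
  | succ i ih =>
    refine ⟨ih.2, ?_⟩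
    have hx' := hx (i + 1)
    have hy' := hy (i + 1)
    simp only [add_sub_cancel_right] at hx' hy'
    rw [← ih.1, ← ih.2, ← hx'] at hy'
    exact (mul_left_cancel₀ (hx0 _) hy').symm
  | pred i ih =>
    have hx' := hx (-i)
    have hy' := hy (-i)
    rw [sub_add_cancel]
    refine ⟨?_, ih.1⟩
    rw [← ih.1, ← ih.2, ← hx'] at hy'
    exact (mul_right_cancel₀ (hx0 _) hy').symm

/-- Finiteness of positive integral friezes in rank 2 for the finite
(Dynkin) types, i.e. when `b·c ≤ 3`. -/
theorem rank2_positive_integral_friezes_finite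
    (b c : ℕ) (hb : 1 ≤ b) (hc : 1 ≤ c) (hbc : b * c ≤ 3) :
    {x : ℤ → ℤ | (∀ i : ℤ, 1 ≤ x i) ∧
      (∀ i : ℤ, (Odd i → x (i - 1) * x (i + 1) = x i ^ b + 1) ∧
        (Even i → x (i - 1) * x (i + 1) = x i ^ c + 1))}.Finite := by
  refine Set.Finite.of_injOn (f := fun x : ℤ → ℤ => (x 0, x 1))
    (t := Set.Icc 1 24 ×ˢ Set.Icc 1 24) ?_ ?_ ((Set.finite_Icc _ _).prod (Set.finite_Icc _ _))
  · rintro x ⟨hpos, hx⟩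
    have hm2 := (hx (-2)).2 (by decide)
    have hm1 := (hx (-1)).1 (by decide)
    have h0 := (hx 0).2 (by decide)
    have h1 := (hx 1).1 (by decide)
    have h2 := (hx 2).2 (by decide)
    have h3 := (hx 3).1 (by decide)
    norm_num at hm2 hm1 h0 h1 h2 h3
    suffices h : x 0 ≤ 24 ∧ x 1 ≤ 24 from ⟨⟨hpos 0, h.1⟩, ⟨hpos 1, h.2⟩⟩
    obtain rfl | rfl : b = 1 ∨ c = 1 := by
      by_contra! h
      have : 2 * 2 ≤ b * c := Nat.mul_le_mul (by lia) (by lia)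
      lia
    · rw [pow_one] at hm1 h1 h3
      obtain ⟨h4, h5⟩ := frieze_entries_le_five hc (by lia) (hpos (-2)) (hpos 0) (hpos 1) (hpos 2)
        (hpos 4) hm1 h0 h1 h2 h3
      exact ⟨by lia, by nlinarith [hpos 0, hpos 2]⟩
    · rw [pow_one] at hm2 h0 h2
      obtain ⟨h4, h5⟩ := frieze_entries_le_five hb (by lia) (hpos (-3)) (hpos (-1)) (hpos 0)
        (hpos 1) (hpos 3) hm2 hm1 h0 h1 h2
      exact ⟨by nlinarith [hpos (-1), hpos 1], by lia⟩
  · rintro x ⟨hxpos, hx⟩ y ⟨-, hy⟩ hxy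
    obtain ⟨h0, h1⟩ := Prod.mk.inj hxy
    refine eq_of_mul_recurrence (f := fun i a => if Even i then a ^ c + 1 else a ^ b + 1)
      (fun i => (zero_lt_one.trans_le (hxpos i)).ne') ?_ ?_ h0 h1
    all_goals
      intro i
      split_ifs with hi
    · exact (hx i).2 hi
    · exact (hx i).1 (Int.not_even_iff_odd.mp hi)
    · exact (hy i).2 hi
    · exact (hy i).1 (Int.not_even_iff_odd.mp hi)
end

section
/- The subset S = {(a, b) ∈ ℝ² : 1 ≤ a, 1 ≤ b, a ≤ b³ + 1, a·b ≤ a + b³ + 1, a²·b³ ≤ b⁶ + 3ab³ + 2b³ + a³ + 3a² + 3a + 1, a·b² ≤ b³ + a² + 2a + 1, a·b³ ≤ a³ + b³ + 3a² + 3a + 1, b ≤ a + 1} of the plane (with its subspace topology) is homeomorphic to the closed unit disc, i.e. to the closed ball of radius 1 centered at the origin in two-dimensional Euclidean space. (The superunitary region of the G₂ cluster algebra is a topological octagon, homeomorphic to the G₂ generalized associahedron.) -/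
open Set Filter Topology Metric Bornology
open scoped Pointwise

section StrictStar

variable {E : Type*} [NormedAddCommGroup E] [NormedSpace ℝ E]

/-- A set is strictly star-shaped about the origin if scaling any of its points by a factor in
`[0, 1)` moves it to the interior. -/
def StrictStar (s : Set E) : Prop :=
  ∀ x ∈ s, ∀ t : ℝ, 0 ≤ t → t < 1 → t • x ∈ interior s

namespace StrictStar

variable {s t : Set E}

theorem mem_nhds_zero (hs : StrictStar s) (hne : s.Nonempty) : s ∈ 𝓝 (0 : E) := by
  obtain ⟨x, hx⟩ := hne
  simpa [mem_interior_iff_mem_nhds] using hs x hx 0 le_rfl one_pos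

theorem mem_smul_interior (hs : StrictStar s) {a b : ℝ} (ha : 0 < a) (hab : a < b) {x : E}
    (hx : x ∈ a • s) : x ∈ b • interior s := by
  obtain ⟨y, hy, rfl⟩ := hx
  have hb : 0 < b := ha.trans hab
  refine ⟨(a / b) • y, hs y hy _ (by positivity) ((div_lt_one hb).2 hab), ?_⟩
  simp only [smul_smul]
  rw [mul_div_cancel₀ _ hb.ne']

theorem continuous_gauge (hs : StrictStar s) (hne : s.Nonempty) (hc : IsClosed s) :
    Continuous (gauge s) := by
  have habs : Absorbent ℝ s := absorbent_nhds_zero (hs.mem_nhds_zero hne)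
  rw [continuous_iff_lower_upperSemicontinuous, lowerSemicontinuous_iff_isClosed_preimage,
    upperSemicontinuous_iff_isOpen_preimage]
  refine ⟨fun r ↦ ?_, fun r ↦ ?_⟩
  · rcases lt_or_ge r 0 with hr | hr
    · convert isClosed_empty
      exact eq_empty_of_forall_notMem fun x hx ↦ (gauge_nonneg x).not_gt (lt_of_le_of_lt hx hr)
    have : gauge s ⁻¹' Iic r = ⋂ (a : ℝ) (_ : r < a), a • s := by
      ext x
      simp only [mem_preimage, mem_Iic, mem_iInter]
      refine ⟨fun h a hra ↦ ?_, fun h ↦ le_of_forall_gt_imp_ge_of_dense fun a hra ↦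
        gauge_le_of_mem (hr.trans hra.le) (h a hra)⟩
      obtain ⟨b, hb, hba, hx⟩ := exists_lt_of_gauge_lt habs (h.trans_lt hra)
      exact smul_set_mono interior_subset (hs.mem_smul_interior hb hba hx)
    rw [this]
    exact isClosed_iInter fun a ↦ isClosed_iInter fun ha ↦
      hc.smul_of_ne_zero (hr.trans_lt ha).ne'
  · have : gauge s ⁻¹' Iio r = ⋃ (a : ℝ) (_ : 0 < a ∧ a < r), a • interior s := by
      ext x
      simp only [mem_preimage, mem_Iio, mem_iUnion]
      refine ⟨fun h ↦ ?_, fun ⟨a, ⟨ha, har⟩, hx⟩ ↦ ?_⟩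
      · obtain ⟨b, hb, hbr, hx⟩ := exists_lt_of_gauge_lt habs h
        obtain ⟨a, hba, har⟩ := exists_between hbr
        exact ⟨a, ⟨hb.trans hba, har⟩, hs.mem_smul_interior hb hba hx⟩
      · exact (gauge_le_of_mem ha.le (smul_set_mono interior_subset hx)).trans_lt har
    rw [this]
    exact isOpen_iUnion fun a ↦ isOpen_iUnion fun ha ↦ isOpen_interior.smul₀ ha.1.ne'

theorem gauge_le_one_iff (hs : StrictStar s) (hne : s.Nonempty) (hc : IsClosed s) {x : E} :
    gauge s x ≤ 1 ↔ x ∈ s := by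
  refine ⟨fun h ↦ ?_, gauge_le_one_of_mem⟩
  have habs : Absorbent ℝ s := absorbent_nhds_zero (hs.mem_nhds_zero hne)
  have hlim : Tendsto (fun a : ℝ ↦ a • x) (𝓝[<] 1) (𝓝 x) := by
    have : Tendsto (fun a : ℝ ↦ a • x) (𝓝 1) (𝓝 ((1 : ℝ) • x)) :=
      (continuous_id.smul continuous_const).tendsto 1
    rw [one_smul] at this
    exact this.mono_left inf_le_left
  refine hc.mem_of_tendsto hlim ?_
  filter_upwards [Ioo_mem_nhdsLT (zero_lt_one' ℝ)] with a ha
  have hlt : gauge s (a • x) < 1 := by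
    rw [gauge_smul_of_nonneg ha.1.le, smul_eq_mul]
    nlinarith [ha.1, ha.2, gauge_nonneg (s := s) x]
  obtain ⟨b, hb, hb1, hx⟩ := exists_lt_of_gauge_lt habs hlt
  simpa using interior_subset (by simpa using hs.mem_smul_interior hb hb1 hx)

theorem continuous_gaugeRescale (hs : StrictStar s) (hsne : s.Nonempty) (hsc : IsClosed s)
    (ht : StrictStar t) (htne : t.Nonempty) (htc : IsClosed t) (htb : IsBounded t) :
    Continuous (gaugeRescale s t) := by
  have ht₀ := ht.mem_nhds_zero htne
  have hta : Absorbent ℝ t := absorbent_nhds_zero ht₀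
  have htv := NormedSpace.isVonNBounded_of_isBounded ℝ htb
  refine continuous_iff_continuousAt.2 fun x ↦ ?_
  rcases eq_or_ne x 0 with rfl | hx
  · rw [ContinuousAt, gaugeRescale_zero]
    nth_rewrite 2 [← comap_gauge_nhds_zero htv ht₀]
    simp only [tendsto_comap_iff, Function.comp_def, gauge_gaugeRescale _ hta htv]
    exact tendsto_gauge_nhds_zero (hs.mem_nhds_zero hsne)
  · exact ((hs.continuous_gauge hsne hsc).continuousAt.div
      (ht.continuous_gauge htne htc).continuousAt ((gauge_pos hta htv).2 hx).ne').smul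
      continuousAt_id

/-- Any two nonempty closed bounded strictly star-shaped sets are homeomorphic. -/
theorem nonempty_homeomorph (hs : StrictStar s) (hsne : s.Nonempty) (hsc : IsClosed s)
    (hsb : IsBounded s) (ht : StrictStar t) (htne : t.Nonempty) (htc : IsClosed t)
    (htb : IsBounded t) : Nonempty (s ≃ₜ t) := by
  have hsa : Absorbent ℝ s := absorbent_nhds_zero (hs.mem_nhds_zero hsne)
  have hta : Absorbent ℝ t := absorbent_nhds_zero (ht.mem_nhds_zero htne)
  have hsv := NormedSpace.isVonNBounded_of_isBounded ℝ hsb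
  have htv := NormedSpace.isVonNBounded_of_isBounded ℝ htb
  let e : E ≃ₜ E :=
    { toEquiv := gaugeRescaleEquiv s t hsa hsv hta htv
      continuous_toFun := hs.continuous_gaugeRescale hsne hsc ht htne htc htb
      continuous_invFun := ht.continuous_gaugeRescale htne htc hs hsne hsc hsb }
  refine ⟨e.subtype fun x ↦ ?_⟩
  change x ∈ s ↔ gaugeRescale s t x ∈ t
  rw [← hs.gauge_le_one_iff hsne hsc, ← ht.gauge_le_one_iff htne htc,
    gauge_gaugeRescale _ hta htv]

/-- A nonempty compact strictly star-shaped set is homeomorphic to the closed unit ball of any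
normed space that is continuously linearly equivalent to the ambient space. -/
theorem nonempty_homeomorph_closedBall (hs : StrictStar s) (hsne : s.Nonempty) (hsc : IsCompact s)
    {V : Type*} [NormedAddCommGroup V] [NormedSpace ℝ V] (L : E ≃L[ℝ] V) :
    Nonempty (s ≃ₜ closedBall (0 : V) 1) := by
  let t : Set E := L ⁻¹' closedBall 0 1
  have ht : StrictStar t := fun x hx a ha₀ ha₁ ↦ by
    refine interior_maximal (preimage_mono ball_subset_closedBall)
      (isOpen_ball.preimage L.continuous) ?_
    have hx' : ‖L x‖ ≤ 1 := by simpa [t] using hx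
    simp only [mem_preimage, map_smul, mem_ball_zero_iff, norm_smul, Real.norm_of_nonneg ha₀]
    nlinarith [norm_nonneg (L x)]
  have htb : IsBounded t := by
    rw [show t = L.symm '' closedBall 0 1 from (L.toEquiv.symm.image_eq_preimage_symm _).symm]
    exact L.symm.lipschitz.isBounded_image isBounded_closedBall
  obtain ⟨e⟩ := hs.nonempty_homeomorph hsne hsc.isClosed hsc.isBounded ht
    ⟨0, by simp [t]⟩ (isClosed_closedBall.preimage L.continuous) htb
  exact ⟨e.trans (L.toHomeomorph.subtype fun _ ↦ Iff.rfl)⟩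

end StrictStar

/-- A basic closed set is strictly star-shaped if its defining functions are positive at the origin
and decrease in the radial direction wherever they vanish on the set. -/
theorem strictStar_setOf_forall_nonneg {ι : Type*} [Finite ι] {F : ι → E → ℝ}
    (hF : ∀ i, Continuous (F i)) (h₀ : ∀ i, 0 < F i 0)
    (h : ∀ x, (∀ i, 0 ≤ F i x) → ∀ i, F i x = 0 →
      ∃ d < 0, HasDerivAt (fun u : ℝ ↦ F i (u • x)) d 1) :
    StrictStar {x | ∀ i, 0 ≤ F i x} := by
  intro x hx t ht₀ ht₁
  have hFx (i : ι) : Continuous fun u : ℝ ↦ F i (u • x) := by fun_prop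
  have hopen : IsOpen {y | ∀ i, 0 < F i y} := by
    simp only [ofPred_forall]
    exact isOpen_iInter_of_finite fun i ↦ isOpen_lt continuous_const (hF i)
  suffices H : ∀ i, 0 < F i (t • x) from
    interior_maximal (fun y hy i ↦ (hy i).le) hopen H
  have hnear : ∀ᶠ u in 𝓝[<] (1 : ℝ), ∀ i, 0 < F i (u • x) := by
    rw [eventually_all]
    intro i
    rcases (hx i).eq_or_lt with h0 | hpos
    · obtain ⟨d, hd, hder⟩ := h x hx i h0.symm
      have := hder.tendsto_slope.mono_left (nhdsLT_le_nhdsNE 1)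
      filter_upwards [this.eventually_lt_const hd, self_mem_nhdsWithin] with u hu hu1
      rw [slope_def_field, one_smul, ← h0, sub_zero] at hu
      exact (div_neg_iff.1 hu).elim (·.1) fun h' ↦ absurd h'.2 (not_lt.2 (sub_neg.2 hu1).le)
    · have : ∀ᶠ u in 𝓝 (1 : ℝ), 0 < F i (u • x) :=
        (hFx i).tendsto 1 |>.eventually_const_lt (by simpa using hpos)
      exact this.filter_mono inf_le_left
  obtain ⟨δ, hδ, hδpos⟩ := (mem_nhdsLT_iff_exists_Ioo_subset).1 hnear
  by_contra! hbad
  let K : Set ℝ := Icc 0 (max δ t) ∩ ⋃ i, {u | F i (u • x) ≤ 0}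
  have hK : IsCompact K := isCompact_Icc.inter_right
    (isClosed_iUnion_of_finite fun i ↦ isClosed_le (hFx i) continuous_const)
  obtain ⟨r, ⟨⟨hr₀, hr₁⟩, hri⟩, hmax⟩ := hK.exists_isGreatest
    ⟨t, ⟨ht₀, le_max_right _ _⟩, mem_iUnion.2 hbad⟩
  obtain ⟨i, hi⟩ := mem_iUnion.1 hri
  have hr1 : r < 1 := hr₁.trans_lt (max_lt hδ ht₁)
  have hr : 0 < r := hr₀.lt_of_ne fun h0 ↦ by
    have := h₀ i
    rw [← h0, mem_ofPred_eq, zero_smul] at hi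
    exact hi.not_gt this
  have hpos (u : ℝ) (hru : r < u) (hu : u < 1) (j : ι) : 0 < F j (u • x) := by
    rcases lt_or_ge δ u with hδu | hδu
    · exact hδpos ⟨hδu, hu⟩ j
    · by_contra! hneg
      exact (hmax ⟨⟨hr.le.trans hru.le, hδu.trans (le_max_left _ _)⟩,
        mem_iUnion.2 ⟨j, hneg⟩⟩).not_gt hru
  have hrx (j : ι) : 0 ≤ F j (r • x) :=
    ge_of_tendsto ((hFx j).continuousWithinAt (s := Ioi r) (x := r))
      (by filter_upwards [Ioo_mem_nhdsGT hr1] with u hu using (hpos u hu.1 hu.2 j).le)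
  have hzero : F i (r • x) = 0 := le_antisymm hi (hrx i)
  obtain ⟨d, hd, hder⟩ := h _ hrx i hzero
  have hslope := (hder.tendsto_slope.mono_left (nhdsGT_le_nhdsNE 1)).eventually_lt_const hd
  have hone : (1 : ℝ) < 1 / r := (one_lt_div hr).2 hr1
  obtain ⟨u, hu, hu1, hur⟩ := (hslope.and (Ioo_mem_nhdsGT hone)).exists
  rw [slope_def_field, one_smul, hzero, sub_zero, smul_smul] at hu
  have := hpos (u * r) (by nlinarith) ((lt_div_iff₀ hr).1 hur) i
  exact hu.not_ge (div_nonneg this.le (sub_pos.2 hu1).le)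

end StrictStar

namespace G2Superunitary

theorem b_le_five {a b : ℝ} (ha : 1 ≤ a) (hb : 1 ≤ b)
    (h3 : a * b ≤ a + b ^ 3 + 1)
    (h4 : a ^ 2 * b ^ 3 ≤ b ^ 6 + 3 * a * b ^ 3 + 2 * b ^ 3 + a ^ 3 + 3 * a ^ 2 + 3 * a + 1)
    (h5 : a * b ^ 2 ≤ b ^ 3 + a ^ 2 + 2 * a + 1)
    (h6 : a * b ^ 3 ≤ a ^ 3 + b ^ 3 + 3 * a ^ 2 + 3 * a + 1)
    (h7 : b ≤ a + 1) : b ≤ 5 := by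
  by_contra! hb5
  have hlow : 2 * b - 1 < a := by
    by_contra! hle
    have e0 : (a + 1) ^ 2 ≤ 4 * b ^ 2 := by nlinarith
    have e1 : (a + 1) ^ 3 ≤ (a + 1) * (4 * b ^ 2) := by nlinarith
    have : (a + 1) * (4 * b ^ 2) < b ^ 3 * (a - 1) := by
      have : 4 * (a + 1) < b * (a - 1) := by nlinarith
      nlinarith
    nlinarith
  have hmid : b ^ 2 - 2 * b - 1 < a := by
    by_contra! hle
    have e2 : 0 < b ^ 2 := by positivity
    nlinarith [mul_nonneg (sub_nonneg.2 hlow.le) (sub_nonneg.2 hle)]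
  have hup : a ≤ b ^ 2 + b + 2 := by
    by_contra! hlt
    nlinarith
  obtain ⟨e, rfl⟩ : ∃ e, a = e + (b ^ 2 - 2 * b - 1) := ⟨a - (b ^ 2 - 2 * b - 1), by ring⟩
  have he : 0 < e := by linarith
  have hbase : 0 < b ^ 3 * ((b - 5) * (b ^ 3 - b ^ 2 - 2)) := by
    have : 0 < b ^ 3 - b ^ 2 - 2 := by nlinarith [mul_pos (sub_pos.2 hb5) (sub_pos.2 hb5)]
    have := sub_pos.2 hb5
    positivity
  obtain ⟨p, hp⟩ : ∃ p, p = b ^ 2 - 2 * b := ⟨_, rfl⟩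
  have hp15 : 15 < p := by nlinarith
  have hsum : 2 * (e + 2 * p) ≤ b ^ 3 := by nlinarith
  have hstep : (e + p) ^ 2 + (e + p) * p + p ^ 2 + 5 * b ^ 3 ≤ b ^ 3 * (e + 2 * p) := by
    have h₁ : (e + 2 * p) * (2 * (e + 2 * p)) ≤ (e + 2 * p) * b ^ 3 := by gcongr
    have h₂ : 10 * b ^ 3 ≤ (e + 2 * p) * b ^ 3 := by gcongr; linarith
    nlinarith [mul_pos he (zero_lt_one.trans (by linarith : 1 < p))]
  have hdrop := mul_le_mul_of_nonneg_left hstep he.le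
  rw [hp] at hdrop
  clear hup h3 h5 h6 h7 hlow hmid hsum hstep
  linarith

theorem radial_deriv_slack_two_neg {a b : ℝ} (hb : 1 ≤ b) (h3 : a * b ≤ a + b ^ 3 + 1)
    (h : b ^ 3 + 1 - a = 0) : 3 * b ^ 2 * (b - 2) - (a - 3) < 0 := by
  have ha : a = b ^ 3 + 1 := by linarith
  subst ha
  have hb2 : b ≤ 2 := by
    by_contra! hlt
    have : 0 < b ^ 3 := by positivity
    nlinarith
  nlinarith [mul_nonneg (sub_nonneg.2 hb) (sub_nonneg.2 hb2)]

theorem radial_deriv_slack_three_neg {a b : ℝ} (hb : 1 ≤ b) (h2 : a ≤ b ^ 3 + 1)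
    (h4 : a ^ 2 * b ^ 3 ≤ b ^ 6 + 3 * a * b ^ 3 + 2 * b ^ 3 + a ^ 3 + 3 * a ^ 2 + 3 * a + 1)
    (h : a + b ^ 3 + 1 - a * b = 0) :
    (1 - b) * (a - 3) + (3 * b ^ 2 - a) * (b - 2) < 0 := by
  have hb0 : 0 < b ^ 3 := by positivity
  have hb2 : 2 ≤ b := by
    by_contra! hlt
    nlinarith
  have hab : a * (b - 1) = b ^ 3 + 1 := by linarith
  have hb3 : b ≤ 3 := by
    have key : (b ^ 3 + 1) ^ 2 * b ^ 3 * (3 - b) =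
        (b - 1) ^ 3 * (b ^ 6 + 3 * a * b ^ 3 + 2 * b ^ 3 + a ^ 3 + 3 * a ^ 2 + 3 * a + 1 -
          a ^ 2 * b ^ 3) := by
      obtain rfl : a = (b ^ 3 + 1) / (b - 1) := by rw [eq_div_iff (by linarith)]; exact hab
      have : b - 1 ≠ 0 := by linarith
      field_simp
      ring
    have h1 : 0 ≤ (b ^ 3 + 1) ^ 2 * b ^ 3 * (3 - b) := by
      rw [key]; apply mul_nonneg
      · have : 0 ≤ b - 1 := by linarith
        positivity
      · linarith
    have := nonneg_of_mul_nonneg_right h1 (by positivity)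
    linarith
  have key : (b - 1) * ((1 - b) * (a - 3) + (3 * b ^ 2 - a) * (b - 2)) =
     b ^ 4 - 2 * b ^ 3 - 2 * b + 1 + 3 * (b - 1) ^ 2 - 2 * (2 * b ^ 3 - 3 * b ^ 2 - 1) := by
    linear_combination ((1 - b) - (b - 2)) * hab
  have : b ^ 4 - 2 * b ^ 3 - 2 * b + 1 + 3 * (b - 1) ^ 2 - 2 * (2 * b ^ 3 - 3 * b ^ 2 - 1) < 0 := by
    nlinarith [mul_nonneg (sub_nonneg.2 hb2) (sub_nonneg.2 hb3),
      mul_nonneg (mul_nonneg (sub_nonneg.2 hb2) (sub_nonneg.2 hb3)) (sub_nonneg.2 hb2)]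
  rw [← key] at this
  exact neg_of_mul_neg_right this (by linarith)

theorem radial_deriv_slack_five_neg {a b : ℝ} (hb : 1 ≤ b)
    (h : b ^ 3 + a ^ 2 + 2 * a + 1 - a * b ^ 2 = 0) :
    (2 * a + 2 - b ^ 2) * (a - 3) + (3 * b ^ 2 - 2 * a * b) * (b - 2) < 0 := by
  have hb0 : 0 < b := by linarith
  obtain ⟨w, hw⟩ : ∃ w, w = (a + 1) / b - 1 := ⟨_, rfl⟩
  have hab : a = (w + 1) * b - 1 := by rw [hw]; field_simp; ring
  have hwb : w * b = (w + 1) ^ 2 + 1 := by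
    rw [hab] at h
    have : b ^ 2 * (w * b - ((w + 1) ^ 2 + 1)) = 0 := by linear_combination -h
    rcases mul_eq_zero.1 this with h' | h'
    · exact absurd h' (by positivity)
    · linarith
  have hw0 : 0 < w := pos_of_mul_pos_left (hwb ▸ by positivity) hb0.le
  have hb_eq : b = (w ^ 2 + 2 * w + 2) / w := by rw [eq_div_iff hw0.ne']; linarith
  have ha_eq : a = (w ^ 2 + 2 * w + 2) / w + (w + 1) ^ 2 := by rw [← hb_eq]; linarith
  have key : ((2 * a + 2 - b ^ 2) * (a - 3) + (3 * b ^ 2 - 2 * a * b) * (b - 2)) * w ^ 3 =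
      -((w ^ 2 + 2 * w + 2) * (w ^ 5 + 6 * w ^ 3 + 8 * w ^ 2)) := by
    rw [ha_eq, hb_eq]
    field_simp
    ring
  have : -((w ^ 2 + 2 * w + 2) * (w ^ 5 + 6 * w ^ 3 + 8 * w ^ 2)) < 0 :=
    neg_lt_zero.2 (by positivity)
  rw [← key] at this
  exact neg_of_mul_neg_left this (by positivity)

theorem radial_deriv_slack_six_neg {a b : ℝ} (ha : 1 ≤ a) (hb : 1 ≤ b) (hb5 : b ≤ 5)
    (h7 : b ≤ a + 1)
    (h : a ^ 3 + b ^ 3 + 3 * a ^ 2 + 3 * a + 1 - a * b ^ 3 = 0) :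
    (3 * (a + 1) ^ 2 - b ^ 3) * (a - 3) + (3 * b ^ 2 - 3 * a * b ^ 2) * (b - 2) < 0 := by
  have hb0 : 0 < b := by linarith
  obtain ⟨t, ht⟩ : ∃ t, t = (a + 1) / b := ⟨_, rfl⟩
  have ht1 : 1 ≤ t := by rw [ht, le_div_iff₀ hb0]; linarith
  have hab : a = t * b - 1 := by rw [ht]; field_simp; ring
  have htb : t * b = t ^ 3 + 2 := by
    rw [hab] at h
    have : b ^ 3 * (t * b - (t ^ 3 + 2)) = 0 := by linear_combination -h
    rcases mul_eq_zero.1 this with h' | h'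
    · exact absurd h' (by positivity)
    · linarith
  have ht2 : t ≤ 2 := by
    by_contra! hlt
    have : t * b ≤ t * 5 := by gcongr
    nlinarith [mul_pos (sub_pos.2 hlt) (sub_pos.2 hlt)]
  have hb_eq : b = (t ^ 3 + 2) / t := by rw [eq_div_iff (by positivity)]; linarith
  have ha_eq : a = t ^ 3 + 1 := by linarith
  have key : ((3 * (a + 1) ^ 2 - b ^ 3) * (a - 3) + (3 * b ^ 2 - 3 * a * b ^ 2) * (b - 2)) * t ^ 3 =
      (t ^ 3 + 2) ^ 2 * (-t ^ 6 + 6 * t ^ 4 - 12 * t ^ 3 + 4) := by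
    rw [ha_eq, hb_eq]
    field_simp
    ring
  have hneg : -t ^ 6 + 6 * t ^ 4 - 12 * t ^ 3 + 4 < 0 := by
    have : 1 ≤ t ^ 3 := one_le_pow₀ ht1
    have : 6 * t - 6 ≤ t ^ 3 := by
      nlinarith [mul_nonneg (sub_nonneg.2 ht1) (sq_nonneg (t - 7 / 5))]
    nlinarith
  have := mul_neg_of_pos_of_neg (by positivity : 0 < (t ^ 3 + 2) ^ 2) hneg
  rw [← key] at this
  exact neg_of_mul_neg_left this (by positivity)

theorem radial_deriv_slack_four_neg {a b : ℝ} (ha : 1 ≤ a) (hb : 1 ≤ b) (hb5 : b ≤ 5)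
    (h3 : a * b ≤ a + b ^ 3 + 1)
    (h : b ^ 6 + 3 * a * b ^ 3 + 2 * b ^ 3 + a ^ 3 + 3 * a ^ 2 + 3 * a + 1 - a ^ 2 * b ^ 3 = 0) :
    (3 * b ^ 3 + 3 * (a + 1) ^ 2 - 2 * a * b ^ 3) * (a - 3) +
      (6 * b ^ 5 + (9 * a + 6) * b ^ 2 - 3 * a ^ 2 * b ^ 2) * (b - 2) < 0 := by
  have hb0 : 0 < b := by linarith
  have ha0 : 0 < a := by linarith
  obtain ⟨s, hs⟩ : ∃ s, s = (a + b ^ 3 + 1) / (a * b) := ⟨_, rfl⟩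
  have hs1 : 1 ≤ s := by rw [hs, le_div_iff₀ (by positivity)]; linarith
  have hab : s * (a * b) = a + b ^ 3 + 1 := by rw [hs]; field_simp
  have hsa : a * (s ^ 3 + 1) = b ^ 3 + 1 := by
    have : a ^ 2 * b ^ 3 * (a * (s ^ 3 + 1) - (b ^ 3 + 1)) = 0 := by
      linear_combination (1 + b ^ 3) * h + ((s * (a * b)) ^ 2 + s * (a * b) * (a + b ^ 3 + 1) + (a + b ^ 3 + 1) ^ 2) * hab
    rcases mul_eq_zero.1 this with h' | h'
    · exact absurd h' (by positivity)
    · linarith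
  have hsb : s * b = s ^ 3 + 2 := by
    have : a * (s * b - (s ^ 3 + 2)) = 0 := by linear_combination hab - hsa
    rcases mul_eq_zero.1 this with h' | h'
    · exact absurd h' (by positivity)
    · linarith
  have hs2 : s ≤ 2 := by
    by_contra! hlt
    have : s * b ≤ s * 5 := by gcongr
    nlinarith [mul_pos (sub_pos.2 hlt) (sub_pos.2 hlt)]
  have hb_eq : b = (s ^ 3 + 2) / s := by rw [eq_div_iff (by positivity)]; linarith
  have ha_eq : a = (s ^ 6 + 5 * s ^ 3 + 8) / s ^ 3 := by
    rw [eq_div_iff (by positivity)]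
    rw [hb_eq] at hsa
    field_simp at hsa
    have : (s ^ 3 + 1) * (a * s ^ 3 - (s ^ 6 + 5 * s ^ 3 + 8)) = 0 := by linear_combination hsa
    rcases mul_eq_zero.1 this with h' | h'
    · exact absurd h' (by positivity)
    · linarith
  have key : ((3 * b ^ 3 + 3 * (a + 1) ^ 2 - 2 * a * b ^ 3) * (a - 3) +
      (6 * b ^ 5 + (9 * a + 6) * b ^ 2 - 3 * a ^ 2 * b ^ 2) * (b - 2)) * s ^ 9 =
      (s ^ 3 + 2) ^ 2 * (s ^ 6 + 5 * s ^ 3 + 8) *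
        (s ^ 3 * (s ^ 3 * (s ^ 3 + 4 - 6 * s) - 36) + 48 * s - 32) := by
    rw [ha_eq, hb_eq]
    field_simp
    ring
  have hneg : s ^ 3 * (s ^ 3 * (s ^ 3 + 4 - 6 * s) - 36) + 48 * s - 32 < 0 := by
    have h₁ : s ≤ s ^ 3 := le_self_pow₀ hs1 (by norm_num)
    have h₂ : s ^ 3 + 4 - 6 * s ≤ 0 := by
      nlinarith [mul_nonneg (sub_nonneg.2 hs1) (sub_nonneg.2 hs2)]
    have h₃ : 0 ≤ s ^ 3 := by positivity
    nlinarith [mul_nonneg (mul_nonneg h₃ h₃) (neg_nonneg.2 h₂)]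
  have := mul_neg_of_pos_of_neg
    (by positivity : 0 < (s ^ 3 + 2) ^ 2 * (s ^ 6 + 5 * s ^ 3 + 8)) hneg
  rw [← key] at this
  exact neg_of_mul_neg_left this (by positivity)

/-- The differences of the two sides of the eight inequalities defining the region. -/
def slack : Fin 8 → ℝ × ℝ → ℝ
  | 0 => fun p ↦ p.1 - 1
  | 1 => fun p ↦ p.2 - 1
  | 2 => fun p ↦ p.2 ^ 3 + 1 - p.1
  | 3 => fun p ↦ p.1 + p.2 ^ 3 + 1 - p.1 * p.2
  | 4 => fun p ↦ p.2 ^ 6 + 3 * p.1 * p.2 ^ 3 + 2 * p.2 ^ 3 + p.1 ^ 3 + 3 * p.1 ^ 2 + 3 * p.1 + 1 -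
      p.1 ^ 2 * p.2 ^ 3
  | 5 => fun p ↦ p.2 ^ 3 + p.1 ^ 2 + 2 * p.1 + 1 - p.1 * p.2 ^ 2
  | 6 => fun p ↦ p.1 ^ 3 + p.2 ^ 3 + 3 * p.1 ^ 2 + 3 * p.1 + 1 - p.1 * p.2 ^ 3
  | 7 => fun p ↦ p.1 + 1 - p.2

theorem continuous_slack (i : Fin 8) : Continuous (slack i) := by
  fin_cases i <;> simp only [slack] <;> fun_prop

theorem slack_nonneg_iff {p : ℝ × ℝ} : (∀ i, 0 ≤ slack i p) ↔ 1 ≤ p.1 ∧ 1 ≤ p.2 ∧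
    p.1 ≤ p.2 ^ 3 + 1 ∧ p.1 * p.2 ≤ p.1 + p.2 ^ 3 + 1 ∧
    p.1 ^ 2 * p.2 ^ 3 ≤
      p.2 ^ 6 + 3 * p.1 * p.2 ^ 3 + 2 * p.2 ^ 3 + p.1 ^ 3 + 3 * p.1 ^ 2 + 3 * p.1 + 1 ∧
    p.1 * p.2 ^ 2 ≤ p.2 ^ 3 + p.1 ^ 2 + 2 * p.1 + 1 ∧
    p.1 * p.2 ^ 3 ≤ p.1 ^ 3 + p.2 ^ 3 + 3 * p.1 ^ 2 + 3 * p.1 + 1 ∧ p.2 ≤ p.1 + 1 := by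
  simp [Fin.forall_fin_succ, slack]

theorem exists_hasDerivAt_slack_neg {p : ℝ × ℝ} (hp : ∀ i, 0 ≤ slack i ((3, 2) + p)) (i : Fin 8)
    (hi : slack i ((3, 2) + p) = 0) :
    ∃ d < 0, HasDerivAt (fun u : ℝ ↦ slack i ((3, 2) + u • p)) d 1 := by
  obtain ⟨a, b, rfl⟩ : ∃ a b, p = (a - 3, b - 2) := ⟨p.1 + 3, p.2 + 2, by simp⟩
  have hA : HasDerivAt (fun u : ℝ ↦ 3 + u * (a - 3)) (a - 3) 1 := by
    simpa using ((hasDerivAt_id (1 : ℝ)).mul_const (a - 3)).const_add 3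
  have hB : HasDerivAt (fun u : ℝ ↦ 2 + u * (b - 2)) (b - 2) 1 := by
    simpa using ((hasDerivAt_id (1 : ℝ)).mul_const (b - 2)).const_add 2
  rw [slack_nonneg_iff] at hp
  simp only [Prod.mk_add_mk, add_sub_cancel] at hp hi
  obtain ⟨h0, h1, h2, h3, h4, h5, h6, h7⟩ := hp
  have hb5 := b_le_five h0 h1 h3 h4 h5 h6 h7
  fin_cases i <;> simp only [slack, Prod.smul_mk, smul_eq_mul, Prod.mk_add_mk] at hi ⊢
  · exact ⟨a - 3, by linarith, hA.sub_const 1⟩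
  · exact ⟨b - 2, by linarith, hB.sub_const 1⟩
  · refine ⟨_, radial_deriv_slack_two_neg h1 h3 hi, ?_⟩
    refine HasDerivAt.congr_deriv
      (((hB.fun_pow 3).add_const 1).fun_sub hA) ?_
    ring
  · refine ⟨_, radial_deriv_slack_three_neg h1 h2 h4 hi, ?_⟩
    refine HasDerivAt.congr_deriv
      (((hA.fun_add (hB.fun_pow 3)).add_const 1).fun_sub (hA.fun_mul hB)) ?_
    ring
  · refine ⟨_, radial_deriv_slack_four_neg h0 h1 hb5 h3 hi, ?_⟩
    refine HasDerivAt.congr_deriv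
      (((((((hB.fun_pow 6).fun_add ((hA.const_mul 3).fun_mul (hB.fun_pow 3))).fun_add
        ((hB.fun_pow 3).const_mul 2)).fun_add (hA.fun_pow 3)).fun_add
        ((hA.fun_pow 2).const_mul 3)).fun_add (hA.const_mul 3)).add_const 1 |>.fun_sub
        ((hA.fun_pow 2).fun_mul (hB.fun_pow 3))) ?_
    ring
  · refine ⟨_, radial_deriv_slack_five_neg h1 hi, ?_⟩
    refine HasDerivAt.congr_deriv
      ((((hB.fun_pow 3).fun_add (hA.fun_pow 2)).fun_add (hA.const_mul 2)).add_const 1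
        |>.fun_sub (hA.fun_mul (hB.fun_pow 2))) ?_
    ring
  · refine ⟨_, radial_deriv_slack_six_neg h0 h1 hb5 h7 hi, ?_⟩
    refine HasDerivAt.congr_deriv
      (((((hA.fun_pow 3).fun_add (hB.fun_pow 3)).fun_add
        ((hA.fun_pow 2).const_mul 3)).fun_add (hA.const_mul 3)).add_const 1
        |>.fun_sub (hA.fun_mul (hB.fun_pow 3))) ?_
    ring
  · exact ⟨(a - 3) - (b - 2), by linarith, (hA.add_const 1).fun_sub hB⟩

theorem isCompact_region : IsCompact {p | ∀ i, 0 ≤ slack i p} := by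
  refine isCompact_of_isClosed_isBounded ?_ ((isBounded_Icc (1 : ℝ × ℝ) (126, 5)).subset ?_)
  · simp only [ofPred_forall]
    exact isClosed_iInter fun i ↦ isClosed_le continuous_const (continuous_slack i)
  · intro p hp
    obtain ⟨h0, h1, h2, h3, h4, h5, h6, h7⟩ := slack_nonneg_iff.1 hp
    have hb5 := b_le_five h0 h1 h3 h4 h5 h6 h7
    have : p.2 ^ 3 ≤ 5 ^ 3 := by gcongr
    exact ⟨⟨h0, h1⟩, ⟨by norm_num at this ⊢; linarith, hb5⟩⟩

end G2Superunitary

open G2Superunitary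

/-- The superunitary region of the `G₂` cluster algebra, embedded in the
plane via the initial cluster, is homeomorphic to the closed unit disc. -/
theorem G2_superunitary_region_homeomorph_closed_disc :
    Nonempty (
      ({p : ℝ × ℝ | 1 ≤ p.1 ∧ 1 ≤ p.2 ∧
          p.1 ≤ p.2 ^ 3 + 1 ∧
          p.1 * p.2 ≤ p.1 + p.2 ^ 3 + 1 ∧
          p.1 ^ 2 * p.2 ^ 3 ≤
            p.2 ^ 6 + 3 * p.1 * p.2 ^ 3 + 2 * p.2 ^ 3 + p.1 ^ 3 +
              3 * p.1 ^ 2 + 3 * p.1 + 1 ∧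
          p.1 * p.2 ^ 2 ≤ p.2 ^ 3 + p.1 ^ 2 + 2 * p.1 + 1 ∧
          p.1 * p.2 ^ 3 ≤ p.1 ^ 3 + p.2 ^ 3 + 3 * p.1 ^ 2 + 3 * p.1 + 1 ∧
          p.2 ≤ p.1 + 1} : Set (ℝ × ℝ)) ≃ₜ
        (Metric.closedBall (0 : EuclideanSpace ℝ (Fin 2)) 1)) := by
  let c : ℝ × ℝ := (3, 2)
  let s : Set (ℝ × ℝ) := {p | ∀ i, 0 ≤ slack i (c + p)}
  have hc (i : Fin 8) : 0 < slack i (c + 0) := by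
    fin_cases i <;> norm_num [slack, c]
  have hs : StrictStar s := strictStar_setOf_forall_nonneg
    (fun i ↦ (continuous_slack i).comp (continuous_const_add c)) hc
    fun p hp i hi ↦ exists_hasDerivAt_slack_neg hp i hi
  have hcpt : IsCompact s := (Homeomorph.addLeft c).isCompact_preimage.2 isCompact_region
  obtain ⟨e⟩ := hs.nonempty_homeomorph_closedBall ⟨0, fun i ↦ (hc i).le⟩ hcpt
    (ContinuousLinearEquiv.ofFinrankEq (by simp) : (ℝ × ℝ) ≃L[ℝ] EuclideanSpace ℝ (Fin 2))
  exact ⟨((Homeomorph.addLeft c).subtype fun p ↦ slack_nonneg_iff).symm.trans e⟩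
end
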